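/- Let X be a finite nonempty type and let q be a probability mass function on X with q x > 0 for all x. For each probability mass function p on X with p x > 0 for all x, let V(p) = sup over functions D : X → ℝ with 0 < D x < 1 for all x of ∑_{x ∈ X} (p x · log(D x) + q x · log(1 − D x)). Then V(p) ≥ −2 · log 2 for every such p, and V(p) = −2 · log 2 if and only if p = q; that is, the agent occupancy measure minimizing the optimal-discriminator objective is exactly the expert occupancy measure. -/

import Mathlib

theorem mul_log_div_add_lower_bound {a b : ℝ} (ha : 0 < a) (hb : 0 < b) :
    -(a * Real.log 2) + (a - b) / 2 ≤ a * Real.log (a / (a + b)) := by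
  have h := Real.log_le_sub_one_of_pos (x := (a + b) / (2 * a)) (by positivity)
  rw [Real.log_div (by positivity) (by positivity), Real.log_mul two_ne_zero ha.ne'] at h
  rw [Real.log_div ha.ne' (by positivity)]
  have h2 := mul_le_mul_of_nonneg_left h ha.le
  have h3 : a * ((a + b) / (2 * a) - 1) = (b - a) / 2 := by
    field_simp
    ring
  linarith

theorem mul_log_div_add_strict_lower_bound {a b : ℝ} (ha : 0 < a) (hb : 0 < b) (hab : a ≠ b) :
    -(a * Real.log 2) + (a - b) / 2 < a * Real.log (a / (a + b)) := by
  have hne : (a + b) / (2 * a) ≠ 1 := by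
    intro h
    rw [div_eq_one_iff_eq (by positivity)] at h
    exact hab (by linarith)
  have h := Real.log_lt_sub_one_of_pos (x := (a + b) / (2 * a)) (by positivity) hne
  rw [Real.log_div (by positivity) (by positivity), Real.log_mul two_ne_zero ha.ne'] at h
  rw [Real.log_div ha.ne' (by positivity)]
  have h2 := mul_lt_mul_of_pos_left h ha
  have h3 : a * ((a + b) / (2 * a) - 1) = (b - a) / 2 := by
    field_simp
    ring
  linarith

theorem log_add_log_one_sub_le {d : ℝ} (hd : d ∈ Set.Ioo (0 : ℝ) 1) :
    Real.log d + Real.log (1 - d) ≤ -(2 * Real.log 2) := by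
  have hd' : 0 < 1 - d := sub_pos.2 hd.2
  have h1 := Real.log_le_sub_one_of_pos (mul_pos two_pos hd.1)
  have h2 := Real.log_le_sub_one_of_pos (mul_pos two_pos hd')
  rw [Real.log_mul two_ne_zero hd.1.ne'] at h1
  rw [Real.log_mul two_ne_zero hd'.ne'] at h2
  linarith

/-- The agent occupancy measure minimizing the optimal-discriminator objective
V(p) is exactly the expert occupancy measure q: V(p) ≥ −2·log 2, with equality
iff p = q. -/
theorem gail_saddle_point_minimizer {X : Type*} [Fintype X] [Nonempty X]
    (q : X → ℝ) (hq0 : ∀ x, 0 < q x) (hq1 : ∑ x, q x = 1) :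
    ∀ p : X → ℝ, (∀ x, 0 < p x) → (∑ x, p x = 1) →
      -(2 * Real.log 2) ≤
        sSup {y : ℝ | ∃ D : X → ℝ, (∀ x, D x ∈ Set.Ioo (0 : ℝ) 1) ∧
          y = ∑ x, (p x * Real.log (D x) + q x * Real.log (1 - D x))} ∧
      (sSup {y : ℝ | ∃ D : X → ℝ, (∀ x, D x ∈ Set.Ioo (0 : ℝ) 1) ∧
          y = ∑ x, (p x * Real.log (D x) + q x * Real.log (1 - D x))}
        = -(2 * Real.log 2) ↔ p = q) := by
  intro p hp0 hp1
  set S := {y : ℝ | ∃ D : X → ℝ, (∀ x, D x ∈ Set.Ioo (0 : ℝ) 1) ∧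
    y = ∑ x, (p x * Real.log (D x) + q x * Real.log (1 - D x))} with hS
  have hbdd : BddAbove S := by
    refine ⟨0, ?_⟩
    rintro y ⟨D, hD, rfl⟩
    refine Finset.sum_nonpos fun x _ => ?_
    have h1 := mul_nonpos_of_nonneg_of_nonpos (hp0 x).le
      (Real.log_nonpos (hD x).1.le (hD x).2.le)
    have h2 := mul_nonpos_of_nonneg_of_nonpos (hq0 x).le
      (Real.log_nonpos (sub_nonneg.2 (hD x).2.le) (sub_le_self 1 (hD x).1.le))
    linarith
  have hopt :
      ∑ x, (p x * Real.log (p x / (p x + q x)) + q x * Real.log (q x / (q x + p x))) ∈ S := by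
    refine ⟨fun x => p x / (p x + q x), fun x => ?_, Finset.sum_congr rfl fun x _ => ?_⟩
    · have hp := hp0 x
      have hq := hq0 x
      exact ⟨by positivity, (div_lt_one (by positivity)).2 (by linarith)⟩
    · have hpq : p x + q x ≠ 0 := (add_pos (hp0 x) (hq0 x)).ne'
      rw [one_sub_div hpq, add_sub_cancel_left, add_comm (q x)]
  have hsum : ∑ x, (-(p x * Real.log 2) + (p x - q x) / 2
      + (-(q x * Real.log 2) + (q x - p x) / 2)) = -(2 * Real.log 2) := by
    calc _ = ∑ x, (p x + q x) * -Real.log 2 := Finset.sum_congr rfl fun x _ => by ring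
      _ = _ := by
        rw [← Finset.sum_mul, Finset.sum_add_distrib, hp1, hq1]
        ring
  have hle := le_csSup hbdd hopt
  have hlb : -(2 * Real.log 2) ≤ sSup S := by
    refine le_trans ?_ hle
    rw [← hsum]
    exact Finset.sum_le_sum fun x _ => add_le_add
      (mul_log_div_add_lower_bound (hp0 x) (hq0 x)) (mul_log_div_add_lower_bound (hq0 x) (hp0 x))
  refine ⟨hlb, fun h => ?_, fun h => le_antisymm (csSup_le ⟨_, hopt⟩ ?_) hlb⟩
  · by_contra hne
    obtain ⟨x, hx⟩ := Function.ne_iff.1 hne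
    refine absurd hle (not_le.2 ?_)
    rw [h, ← hsum]
    exact Finset.sum_lt_sum
      (fun x _ => add_le_add (mul_log_div_add_lower_bound (hp0 x) (hq0 x))
        (mul_log_div_add_lower_bound (hq0 x) (hp0 x)))
      ⟨x, Finset.mem_univ x, add_lt_add (mul_log_div_add_strict_lower_bound (hp0 x) (hq0 x) hx)
        (mul_log_div_add_strict_lower_bound (hq0 x) (hp0 x) hx.symm)⟩
  · rintro y ⟨D, hD, rfl⟩
    calc _ ≤ ∑ x, q x * -(2 * Real.log 2) := by
          refine Finset.sum_le_sum fun x _ => ?_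
          rw [h, ← mul_add]
          exact mul_le_mul_of_nonneg_left (log_add_log_one_sub_le (hD x)) (hq0 x).le
      _ = _ := by rw [← Finset.sum_mul, hq1, one_mul]
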